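/- arXiv:1805.01960 — 3 statements merged into one kernel-verified Lean document; each statement's English description precedes it below -/
import Mathlib

section
/- Average treatment effect equals the prima facie effect under ignorability: Let X be a random variable on a probability space (Ω, P) taking values in a finite type containing two distinguished values t and c with P(X = t) > 0 and P(X = c) > 0, and let Y, Y_t, Y_c be integrable real-valued random variables. Assume (i) consistency: Y_t = Y almost surely on {X = t} and Y_c = Y almost surely on {X = c}; (ii) ignorability: Y_t is independent of X and Y_c is independent of X. Then E[Y_t − Y_c] = E[Y | X = t] − E[Y | X = c], where E[Y | X = t] := (1 / P(X = t)) · ∫_{X = t} Y dP and similarly for c. -/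
open MeasureTheory ProbabilityTheory

lemma aux_prima_facie
    {Ω : Type*} [MeasurableSpace Ω] (P : Measure Ω) [IsProbabilityMeasure P]
    {α : Type*} [MeasurableSpace α] [MeasurableSingletonClass α]
    (X : Ω → α) (t : α) (ht : 0 < P {ω | X ω = t})
    (Y Z : Ω → ℝ) (hY : Integrable Y P) (hZ : Integrable Z P)
    (cons : ∀ᵐ ω ∂P, X ω = t → Z ω = Y ω) (ind : IndepFun Z X P) :
    (P {ω | X ω = t}).toReal⁻¹ * ∫ ω in {ω | X ω = t}, Y ω ∂P = ∫ ω, Z ω ∂P := by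
  have hZr : AEMeasurable Z (P.restrict {ω | X ω = t}) := hZ.aemeasurable.restrict
  have hYr : AEMeasurable Y (P.restrict {ω | X ω = t}) := hY.aemeasurable.restrict
  have h1 : ∫ ω in {ω | X ω = t}, Y ω ∂P = ∫ ω in {ω | X ω = t}, Z ω ∂P := by
    apply integral_congr_ae
    have : ∀ᵐ ω ∂(P.restrict {ω | X ω = t}), Z ω = Y ω :=
      (ae_restrict_iff₀ (nullMeasurableSet_eq_fun hZr hYr)).2 cons
    filter_upwards [this] with ω h using h.symm
  have hmap : (P.restrict {ω | X ω = t}).map Z = P {ω | X ω = t} • P.map Z := by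
    ext A hA
    rw [Measure.map_apply_of_aemeasurable hZr hA, Measure.smul_apply,
      Measure.map_apply_of_aemeasurable hZ.aemeasurable hA,
      Measure.restrict_apply₀ (hZr.nullMeasurableSet_preimage hA)]
    have := ind.measure_inter_preimage_eq_mul A {t} hA (measurableSet_singleton t)
    rw [smul_eq_mul, mul_comm]
    exact this
  have h2 : ∫ ω in {ω | X ω = t}, Z ω ∂P = (P {ω | X ω = t}).toReal * ∫ ω, Z ω ∂P := by
    have e1 := integral_map hZr (f := fun x : ℝ => x) aestronglyMeasurable_id
    have e2 := integral_map hZ.aemeasurable (f := fun x : ℝ => x) aestronglyMeasurable_id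
    rw [← e1, ← e2, hmap, integral_smul_measure, smul_eq_mul]
  have h0 : (P {ω | X ω = t}).toReal ≠ 0 :=
    (ENNReal.toReal_pos ht.ne' (measure_ne_top _ _)).ne'
  rw [h1, h2, inv_mul_cancel_left₀ h0]

/-- Average treatment effect equals the prima facie effect under ignorability:
under consistency on the treated/control events and independence of each
potential outcome from treatment assignment,
`E[Yt − Yc] = E[Y | X = t] − E[Y | X = c]`. -/
theorem ate_eq_prima_facie_effect
    {Ω : Type*} [MeasurableSpace Ω] (P : Measure Ω) [IsProbabilityMeasure P]
    {α : Type*} [Fintype α] [MeasurableSpace α] [MeasurableSingletonClass α]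
    (X : Ω → α) (t c : α)
    (ht : 0 < P {ω | X ω = t}) (hc : 0 < P {ω | X ω = c})
    (Y Yt Yc : Ω → ℝ)
    (hY : Integrable Y P) (hYt : Integrable Yt P) (hYc : Integrable Yc P)
    (cons_t : ∀ᵐ ω ∂P, X ω = t → Yt ω = Y ω)
    (cons_c : ∀ᵐ ω ∂P, X ω = c → Yc ω = Y ω)
    (ind_t : IndepFun Yt X P)
    (ind_c : IndepFun Yc X P) :
    ∫ ω, (Yt ω - Yc ω) ∂P
      = (P {ω | X ω = t}).toReal⁻¹ * ∫ ω in {ω | X ω = t}, Y ω ∂P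
        - (P {ω | X ω = c}).toReal⁻¹ * ∫ ω in {ω | X ω = c}, Y ω ∂P := by
  rw [aux_prima_facie P X t ht Y Yt hY hYt cons_t ind_t,
    aux_prima_facie P X c hc Y Yc hY hYc cons_c ind_c, integral_sub hYt hYc]
end

section
/- Adjusting for a mediator can bias the estimate of causal effect: There exist a probability space (Ω, P), mutually independent random variables X, ε_Z, ε_Y taking values in finite types, functions f_Z and f_Y, and values x, y, such that, defining Z(ω) = f_Z(X(ω), ε_Z(ω)), Y(ω) = f_Y(X(ω), Z(ω), ε_Y(ω)), and the potential outcome Y_x(ω) = f_Y(x, f_Z(x, ε_Z(ω)), ε_Y(ω)), the positivity condition P(X = x ∧ Z = z) > 0 holds for every value z, yet Σ_z P(Y = y | X = x, Z = z) · P(Z = z) ≠ P(Y_x = y). -/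
open MeasureTheory

noncomputable def medP : Measure (Bool × Bool) := (4 : ENNReal)⁻¹ • Measure.count

lemma medP_apply (p : Bool × Bool → Prop) [DecidablePred p] (n : ℕ)
    (h : (Finset.univ.filter p).card = n) : medP {ω | p ω} = (4 : ENNReal)⁻¹ * n := by
  have : {ω | p ω} = ((Finset.univ.filter p : Finset (Bool × Bool)) : Set (Bool × Bool)) := by
    ext; simp
  rw [medP, Measure.smul_apply, this, Measure.count_apply_finset, h, smul_eq_mul]

instance medP_prob : IsProbabilityMeasure medP := by
  constructor
  have := medP_apply (fun _ => True) 4 (by decide)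
  rw [Set.setOf_true] at this
  rw [this]
  exact ENNReal.inv_mul_cancel (by norm_num) (by norm_num)

lemma med_half : (4 : ENNReal)⁻¹ * (2 : ℕ) * ((4 : ENNReal)⁻¹ * (2 : ℕ)) *
    ((4 : ENNReal)⁻¹ * (4 : ℕ)) = (4 : ENNReal)⁻¹ * (1 : ℕ) := by
  rw [← ENNReal.toReal_eq_toReal_iff' (by finiteness) (by finiteness)]
  simp
  norm_num

/-- Adjusting for a mediator can bias the estimate of causal effect: there is a
structural model `Z = f_Z(X, εZ)`, `Y = f_Y(X, Z, εY)` with mutually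
independent `X, εZ, εY` and positivity, in which the adjustment-for-direct-causes
formula `∑ z, P(Y = y | X = x, Z = z) * P(Z = z)` differs from the true
interventional probability `P(Yx = y)` with `Yx = f_Y(x, f_Z(x, εZ), εY)`. -/
theorem adjusting_for_mediator_biased :
    ∃ (Ω : Type) (_ : MeasurableSpace Ω) (P : Measure Ω) (_ : IsProbabilityMeasure P)
      (χ ζ γ E₁ E₂ : Type) (_ : Fintype χ) (_ : Fintype ζ) (_ : Fintype γ)
      (_ : Fintype E₁) (_ : Fintype E₂)
      (X : Ω → χ) (eZ : Ω → E₁) (eY : Ω → E₂)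
      (fZ : χ → E₁ → ζ) (fY : χ → ζ → E₂ → γ)
      (Z : Ω → ζ) (Y : Ω → γ) (Yx : Ω → γ) (x : χ) (y : γ),
      (∀ ω, Z ω = fZ (X ω) (eZ ω)) ∧
      (∀ ω, Y ω = fY (X ω) (Z ω) (eY ω)) ∧
      (∀ ω, Yx ω = fY x (fZ x (eZ ω)) (eY ω)) ∧
      (∀ (a : χ) (b : E₁) (c : E₂),
        P {ω | X ω = a ∧ eZ ω = b ∧ eY ω = c}
          = P {ω | X ω = a} * P {ω | eZ ω = b} * P {ω | eY ω = c}) ∧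
      (∀ z : ζ, 0 < P {ω | X ω = x ∧ Z ω = z}) ∧
      (∑ z : ζ,
          (P {ω | Y ω = y ∧ X ω = x ∧ Z ω = z} / P {ω | X ω = x ∧ Z ω = z})
            * P {ω | Z ω = z})
        ≠ P {ω | Yx ω = y} := by
  refine ⟨Bool × Bool, inferInstance, medP, medP_prob, Bool, Bool, Bool, Bool, Unit,
    inferInstance, inferInstance, inferInstance, inferInstance, inferInstance,
    Prod.fst, Prod.snd, fun _ => (), fun a b => a && b, fun _ z _ => z,
    fun ω => ω.1 && ω.2, fun ω => ω.1 && ω.2, fun ω => true && ω.2, true, true,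
    fun _ => rfl, fun _ => rfl, fun _ => rfl, ?_, ?_, ?_⟩
  · intro a b c
    rw [medP_apply _ 1 (by revert a b c; decide), medP_apply _ 2 (by revert a; decide),
      medP_apply _ 2 (by revert b; decide), medP_apply _ 4 (by revert c; decide), med_half]
  · intro z
    rw [medP_apply _ 1 (by revert z; decide)]
    simp
  · rw [Fintype.sum_bool, medP_apply _ 1 (by decide), medP_apply _ 1 (by decide),
      medP_apply _ 1 (by decide), medP_apply _ 0 (by decide), medP_apply _ 1 (by decide),
      medP_apply _ 3 (by decide), medP_apply _ 2 (by decide)]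
    rw [ENNReal.div_self (by simp) (by finiteness)]
    intro h
    have := congrArg ENNReal.toReal h
    simp at this
end

section
/- Non-identifiability of causal effect under latent confounding (bow-arc model): There exist two probability spaces (Ω₁, P₁) and (Ω₂, P₂); on the first, mutually independent random variables U, ε_X, ε_Y with values in finite types and functions f_X, f_Y defining X(ω) = f_X(U(ω), ε_X(ω)) and Y(ω) = f_Y(X(ω), U(ω), ε_Y(ω)); on the second, mutually independent random variables U′, ε′_X, ε′_Y and functions f′_X, f′_Y defining X′ and Y′ analogously; and a value x; such that the joint laws coincide, i.e. P₁(X = a ∧ Y = b) = P₂(X′ = a ∧ Y′ = b) for all values a, b, yet the interventional distributions differ: for some value y, P₁(f_Y(x, U, ε_Y) = y) ≠ P₂(f′_Y(x, U′, ε′_Y) = y). -/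
open MeasureTheory

/-- Non-identifiability of causal effect under latent confounding (bow-arc
model): there are two structural models `X = f_X(U, εX)`, `Y = f_Y(X, U, εY)`
with mutually independent background variables whose observational joint
distributions of `(X, Y)` coincide, yet whose interventional distributions
`P(f_Y(x, U, εY) = y)` differ. -/
theorem bow_arc_non_identifiability :
    ∃ (Ω₁ : Type) (_ : MeasurableSpace Ω₁) (P₁ : Measure Ω₁) (_ : IsProbabilityMeasure P₁)
      (Ω₂ : Type) (_ : MeasurableSpace Ω₂) (P₂ : Measure Ω₂) (_ : IsProbabilityMeasure P₂)
      (υ₁ E₁ E₂ υ₂ E₃ E₄ χ γ : Type)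
      (_ : Fintype υ₁) (_ : Fintype E₁) (_ : Fintype E₂)
      (_ : Fintype υ₂) (_ : Fintype E₃) (_ : Fintype E₄)
      (_ : Fintype χ) (_ : Fintype γ)
      (U : Ω₁ → υ₁) (eX : Ω₁ → E₁) (eY : Ω₁ → E₂)
      (fX : υ₁ → E₁ → χ) (fY : χ → υ₁ → E₂ → γ)
      (U' : Ω₂ → υ₂) (eX' : Ω₂ → E₃) (eY' : Ω₂ → E₄)
      (fX' : υ₂ → E₃ → χ) (fY' : χ → υ₂ → E₄ → γ)
      (X : Ω₁ → χ) (Y : Ω₁ → γ) (X' : Ω₂ → χ) (Y' : Ω₂ → γ) (x : χ),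
      (∀ ω, X ω = fX (U ω) (eX ω)) ∧
      (∀ ω, Y ω = fY (X ω) (U ω) (eY ω)) ∧
      (∀ ω, X' ω = fX' (U' ω) (eX' ω)) ∧
      (∀ ω, Y' ω = fY' (X' ω) (U' ω) (eY' ω)) ∧
      (∀ (u : υ₁) (a : E₁) (b : E₂),
        P₁ {ω | U ω = u ∧ eX ω = a ∧ eY ω = b}
          = P₁ {ω | U ω = u} * P₁ {ω | eX ω = a} * P₁ {ω | eY ω = b}) ∧
      (∀ (u : υ₂) (a : E₃) (b : E₄),
        P₂ {ω | U' ω = u ∧ eX' ω = a ∧ eY' ω = b}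
          = P₂ {ω | U' ω = u} * P₂ {ω | eX' ω = a} * P₂ {ω | eY' ω = b}) ∧
      (∀ (a : χ) (b : γ),
        P₁ {ω | X ω = a ∧ Y ω = b} = P₂ {ω | X' ω = a ∧ Y' ω = b}) ∧
      (∃ y : γ,
        P₁ {ω | fY x (U ω) (eY ω) = y} ≠ P₂ {ω | fY' x (U' ω) (eY' ω) = y}) := by
  have hP : IsProbabilityMeasure (PMF.uniformOfFintype Bool).toMeasure := inferInstance
  refine ⟨Bool, ⊤, (PMF.uniformOfFintype Bool).toMeasure, hP,
    Bool, ⊤, (PMF.uniformOfFintype Bool).toMeasure, hP,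
    Bool, Unit, Unit, Bool, Unit, Unit, Bool, Bool,
    inferInstance, inferInstance, inferInstance, inferInstance, inferInstance, inferInstance,
    inferInstance, inferInstance,
    id, fun _ => (), fun _ => (), fun u _ => u, fun x _ _ => x,
    id, fun _ => (), fun _ => (), fun u _ => u, fun _ u _ => u,
    id, id, id, id, true,
    fun _ => rfl, fun _ => rfl, fun _ => rfl, fun _ => rfl, ?_, ?_, fun _ _ => rfl, true, ?_⟩
  · intro u a b
    simp [ENNReal.mul_inv_cancel]
  · intro u a b
    simp [ENNReal.mul_inv_cancel]
  · have h1 : {ω : Bool | id ω = true} = {true} := by ext; simp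
    have h2 : {ω : Bool | true = true} = Set.univ := by ext; simp
    rw [h1, h2, measure_univ,
      PMF.toMeasure_apply_singleton _ _ (MeasurableSet.singleton _)]
    simp only [PMF.uniformOfFintype_apply, Fintype.card_bool]
    intro h
    have h' := congrArg ENNReal.toReal h
    norm_num at h'
end
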